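/- For each integer h ≥ 2, the limit γ_h := lim_{n→∞} a_h(n)/b_h(n) exists, satisfies γ_h > 1, and γ_h → log(4)/log(3) as h → ∞. -/

import Mathlib

open Finset

/-- The number of parts of the partition `P` that are greater than `j`;
this is the length of column `j` (0-indexed) of the Ferrers diagram,
i.e. the conjugate part `λ'_{j+1}`. -/
def colLen {n : ℕ} (P : Nat.Partition n) (j : ℕ) : ℕ :=
  (P.parts.filter (fun p => j < p)).card

/-- The length of row `i` (0-indexed) of the Ferrers diagram of `P`,
i.e. the `(i+1)`-st largest part `λ_{i+1}` (or `0` if there is none). -/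
def rowLen {n : ℕ} (P : Nat.Partition n) (i : ℕ) : ℕ :=
  ((Finset.range (n + 1)).filter (fun j => i < colLen P j)).card

/-- The number of cells of the Ferrers diagram of `P` whose hook number
`(λ_i − j) + (λ'_j − i) + 1` (1-indexed) equals `h`. -/
def hookCount {n : ℕ} (P : Nat.Partition n) (h : ℕ) : ℕ :=
  (((Finset.range (n + 1)) ×ˢ (Finset.range (n + 1))).filter
    (fun ij => ij.2 < rowLen P ij.1 ∧
      rowLen P ij.1 + colLen P ij.2 = h + ij.1 + ij.2 + 1)).card

/-- `a h n`: the total number of hooks of length `h` among partitions of `n` into odd parts. -/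
def hookOdd (h n : ℕ) : ℕ := ∑ P ∈ Nat.Partition.odds n, hookCount P h

/-- `b h n`: the total number of hooks of length `h` among partitions of `n` into distinct parts. -/
def hookDistinct (h n : ℕ) : ℕ := ∑ P ∈ Nat.Partition.distincts n, hookCount P h

/-- One step along the boundary path of the diagram with multiset of parts `M`: in state `(p, k)`,
`k` rows of length `p` have been traversed; move along a further such row if there is one,
and to length `p + 1` otherwise. -/
def pathStep (M : Multiset ℕ) (s : ℕ × ℕ) : ℕ × ℕ :=
  if s.2 < M.count s.1 then (s.1, s.2 + 1) else (s.1 + 1, 0)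

/-- The indicator that step `r` of the boundary path started in state `(p, k)` is vertical
(for `r ≥ 1`). -/
def vertInd (M : Multiset ℕ) (r p k : ℕ) : ℕ :=
  if 0 < ((pathStep M)^[r] (p, k)).2 then 1 else 0

lemma colLen_anti {n : ℕ} (P : Nat.Partition n) : Antitone (colLen P) := by
  intro a b hab
  exact Multiset.card_le_card (Multiset.monotone_filter_right _ fun x hx => lt_of_le_of_lt hab hx)

lemma colLen_le {n : ℕ} (P : Nat.Partition n) (j : ℕ) : colLen P j ≤ n := by
  refine (Multiset.card_le_card (Multiset.filter_le _ _)).trans ?_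
  have := Multiset.card_nsmul_le_sum (s := P.parts) (a := 1) fun x hx => P.parts_pos hx
  simpa [P.parts_sum] using this

lemma part_le {n : ℕ} (P : Nat.Partition n) {x : ℕ} (hx : x ∈ P.parts) : x ≤ n := by
  have := Multiset.le_sum_of_mem hx
  rwa [P.parts_sum] at this

lemma lt_of_colLen_pos {n : ℕ} (P : Nat.Partition n) {j : ℕ} (h : 0 < colLen P j) : j < n := by
  obtain ⟨x, hx⟩ := Multiset.card_pos_iff_exists_mem.1 h
  rw [Multiset.mem_filter] at hx
  exact hx.2.trans_le (part_le P hx.1)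

lemma colLen_eq_succ {n : ℕ} (P : Nat.Partition n) (j : ℕ) :
    colLen P j = colLen P (j + 1) + P.parts.count (j + 1) := by
  unfold colLen
  induction P.parts using Multiset.induction_on with
  | empty => simp
  | cons x s ih =>
    simp only [Multiset.filter_cons, Multiset.card_add, Multiset.count_cons]
    split_ifs <;> simp <;> omega

lemma lt_rowLen_iff {n : ℕ} (P : Nat.Partition n) (i j : ℕ) :
    j < rowLen P i ↔ i < colLen P j := by
  unfold rowLen
  constructor
  · intro h
    by_contra hc
    have : (Finset.range (n + 1)).filter (fun j => i < colLen P j) ⊆ Finset.range j := by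
      intro x hx
      rw [Finset.mem_filter] at hx
      rw [Finset.mem_range]
      by_contra hx'
      exact hc (hx.2.trans_le (colLen_anti P (not_lt.1 hx')))
    have := Finset.card_le_card this
    rw [Finset.card_range] at this
    omega
  · intro h
    have : Finset.range (j + 1) ⊆ (Finset.range (n + 1)).filter (fun j => i < colLen P j) := by
      intro x hx
      have hj := lt_of_colLen_pos P (Nat.zero_lt_of_lt h)
      rw [Finset.mem_range] at hx
      rw [Finset.mem_filter, Finset.mem_range]
      exact ⟨by omega, h.trans_le (colLen_anti P (by omega))⟩
    have := Finset.card_le_card this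
    rw [Finset.card_range] at this
    omega

lemma pathStep_iterate_spec {n : ℕ} (P : Nat.Partition n) (j r : ℕ) :
    ∃ p k, (pathStep P.parts)^[r] (j + 1, 0) = (p + 1, k) ∧ k ≤ P.parts.count (p + 1) ∧
      p + k + colLen P j = j + r + colLen P p := by
  induction r with
  | zero => exact ⟨j, 0, rfl, Nat.zero_le _, by omega⟩
  | succ r ih =>
    obtain ⟨p, k, h1, h2, h3⟩ := ih
    rw [Function.iterate_succ_apply', h1]
    by_cases hk : k < P.parts.count (p + 1)
    · exact ⟨p, k + 1, by simp [pathStep, hk], hk, by omega⟩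
    · refine ⟨p + 1, 0, by simp [pathStep, hk], Nat.zero_le _, ?_⟩
      have := colLen_eq_succ P p
      omega

lemma hookCount_eq {n : ℕ} (P : Nat.Partition n) (h : ℕ) :
    hookCount P h = ∑ j ∈ Finset.range (n + 1), vertInd P.parts h (j + 1) 0 := by
  unfold hookCount
  rw [Finset.card_filter, Finset.sum_product_right]
  refine Finset.sum_congr rfl fun j _ => ?_
  rw [← Finset.card_filter]
  obtain ⟨p, k, h1, h2, h3⟩ := pathStep_iterate_spec P j h
  have key : ∀ i, (j < rowLen P i ∧ rowLen P i + colLen P j = h + i + j + 1) →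
      0 < k ∧ i + k = colLen P p := by
    rintro i ⟨hj, hh⟩
    obtain ⟨p0, hp0⟩ : ∃ p0, rowLen P i = p0 + 1 := ⟨rowLen P i - 1, by omega⟩
    have a1 := (lt_rowLen_iff P i p0).1 (by omega)
    have a2 := mt (lt_rowLen_iff P i (p0 + 1)).2 (by omega)
    have a3 := colLen_eq_succ P p
    have a4 := colLen_eq_succ P p0
    rcases lt_trichotomy p p0 with hlt | heq | hgt
    · have := colLen_anti P (show p + 1 ≤ p0 by omega)
      omega
    · subst heq
      omega
    · have := colLen_anti P (show p0 + 1 ≤ p by omega)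
      omega
  unfold vertInd
  rw [h1]
  split_ifs with hk
  · rw [Finset.card_eq_one]
    simp only at hk
    have a3 := colLen_eq_succ P p
    have a4 := colLen_le P p
    have a1 := (lt_rowLen_iff P (colLen P p - k) p).2 (by omega)
    have a2 := mt (lt_rowLen_iff P (colLen P p - k) (p + 1)).1 (by omega)
    refine ⟨colLen P p - k, ?_⟩
    ext i
    rw [Finset.mem_filter, Finset.mem_singleton, Finset.mem_range]
    constructor
    · rintro ⟨_, hi⟩
      have := key i hi
      omega
    · rintro rfl
      dsimp only
      refine ⟨by omega, ?_, by omega⟩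
      rw [lt_rowLen_iff]
      by_contra hc
      rcases le_or_gt j p with hjp | hjp
      · have := colLen_anti P hjp
        omega
      · have := colLen_anti P (show p + 1 ≤ j by omega)
        omega
  · rw [Finset.card_eq_zero]
    refine Finset.filter_eq_empty_iff.2 fun i _ hi => ?_
    exact hk (key i hi).1

/-- The multisets of parts of the partitions of `n` into odd parts. -/
def oddParts (n : ℕ) : Finset (Multiset ℕ) := (Nat.Partition.odds n).image (·.parts)

/-- The multisets of parts of the partitions of `n` into distinct parts. -/
def distinctParts (n : ℕ) : Finset (Multiset ℕ) := (Nat.Partition.distincts n).image (·.parts)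

lemma mem_oddParts {n : ℕ} {M : Multiset ℕ} :
    M ∈ oddParts n ↔ (∀ x ∈ M, Odd x) ∧ M.sum = n := by
  simp only [oddParts, Finset.mem_image, Nat.Partition.odds, Nat.Partition.restricted,
    Finset.mem_filter, Finset.mem_univ, true_and, Nat.not_even_iff_odd]
  constructor
  · rintro ⟨P, hP, rfl⟩
    exact ⟨hP, P.parts_sum⟩
  · rintro ⟨h1, h2⟩
    exact ⟨⟨M, fun hx => (h1 _ hx).pos, h2⟩, h1, rfl⟩

lemma mem_distinctParts {n : ℕ} {M : Multiset ℕ} :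
    M ∈ distinctParts n ↔ M.Nodup ∧ (∀ x ∈ M, 0 < x) ∧ M.sum = n := by
  simp only [distinctParts, Finset.mem_image, Nat.Partition.distincts,
    Finset.mem_filter, Finset.mem_univ, true_and]
  constructor
  · rintro ⟨P, hP, rfl⟩
    exact ⟨hP, fun x hx => P.parts_pos hx, P.parts_sum⟩
  · rintro ⟨h1, h2, h3⟩
    exact ⟨⟨M, fun hx => h2 _ hx, h3⟩, h1, rfl⟩

lemma parts_injective (n : ℕ) : Function.Injective (fun P : Nat.Partition n => P.parts) :=
  fun _ _ h => Nat.Partition.ext h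

lemma card_distinctParts (n : ℕ) : (distinctParts n).card = (oddParts n).card := by
  rw [distinctParts, oddParts, Finset.card_image_of_injective _ (parts_injective n),
    Finset.card_image_of_injective _ (parts_injective n),
    Nat.Partition.card_odds_eq_card_distincts]

lemma hookOdd_eq (h n : ℕ) :
    hookOdd h n = ∑ M ∈ oddParts n, ∑ j ∈ Finset.range (n + 1), vertInd M h (j + 1) 0 := by
  rw [oddParts, Finset.sum_image (fun _ _ _ _ h => parts_injective n h)]
  exact Finset.sum_congr rfl fun P _ => hookCount_eq P h

lemma hookDistinct_eq (h n : ℕ) :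
    hookDistinct h n =
      ∑ M ∈ distinctParts n, ∑ j ∈ Finset.range (n + 1), vertInd M h (j + 1) 0 := by
  rw [distinctParts, Finset.sum_image (fun _ _ _ _ h => parts_injective n h)]
  exact Finset.sum_congr rfl fun P _ => hookCount_eq P h

lemma card_oddParts_mono : Monotone fun n => (oddParts n).card := by
  refine monotone_nat_of_le_succ fun n => ?_
  refine Finset.card_le_card_of_injOn (fun M => 1 ::ₘ M) ?_ ?_
  · intro M hM
    rw [Finset.mem_coe, mem_oddParts] at hM ⊢
    refine ⟨?_, by rw [Multiset.sum_cons, hM.2, add_comm]⟩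
    intro x hx
    rcases Multiset.mem_cons.1 hx with rfl | hx
    · exact odd_one
    · exact hM.1 x hx
  · intro M _ N _ h
    exact (Multiset.cons_inj_right 1).1 h

lemma card_oddParts_filter_le {U : Multiset ℕ} (hU : ∀ x ∈ U, Odd x) (n : ℕ) :
    ((oddParts n).filter (U ≤ ·)).card =
      if U.sum ≤ n then (oddParts (n - U.sum)).card else 0 := by
  split_ifs with h
  · refine Finset.card_bij' (fun M _ => M - U) (fun M _ => M + U) ?_ ?_ ?_ ?_
    · intro M hM
      rw [Finset.mem_filter, mem_oddParts] at hM
      rw [mem_oddParts]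
      refine ⟨fun x hx => hM.1.1 x (Multiset.mem_of_le (Multiset.sub_le_self _ _) hx), ?_⟩
      have := congrArg Multiset.sum (tsub_add_cancel_of_le hM.2)
      rw [Multiset.sum_add, hM.1.2] at this
      omega
    · intro M hM
      rw [mem_oddParts] at hM
      rw [Finset.mem_filter, mem_oddParts]
      refine ⟨⟨fun x hx => ?_, ?_⟩, Multiset.le_add_left _ _⟩
      · rcases Multiset.mem_add.1 hx with hx | hx
        · exact hM.1 x hx
        · exact hU x hx
      · rw [Multiset.sum_add, hM.2]
        omega
    · intro M hM
      exact tsub_add_cancel_of_le (Finset.mem_filter.1 hM).2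
    · intro M hM
      exact add_tsub_cancel_right _ _
  · rw [Finset.card_eq_zero]
    refine Finset.filter_eq_empty_iff.2 fun M hM hle => h ?_
    obtain ⟨V, rfl⟩ := Multiset.le_iff_exists_add.1 hle
    have := (mem_oddParts.1 hM).2
    rw [Multiset.sum_add] at this
    omega

lemma card_distinctParts_cons {U : Multiset ℕ} {x : ℕ} (hx : x ∉ U) (hx0 : 0 < x) (n : ℕ) :
    ((distinctParts (n + x)).filter (x ::ₘ U ≤ ·)).card +
      ((distinctParts n).filter (x ::ₘ U ≤ ·)).card =
      ((distinctParts n).filter (U ≤ ·)).card := by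
  rw [← Finset.card_filter_add_card_filter_not (s := (distinctParts n).filter (U ≤ ·))
    (fun M => x ∉ M), Finset.filter_filter, Finset.filter_filter]
  congr 1
  · symm
    refine Finset.card_bij' (fun M _ => x ::ₘ M) (fun M _ => M.erase x) ?_ ?_ ?_ ?_
    · intro M hM
      rw [Finset.mem_filter, mem_distinctParts] at hM
      obtain ⟨⟨h1, h2, h3⟩, h4, h5⟩ := hM
      rw [Finset.mem_filter, mem_distinctParts]
      refine ⟨⟨Multiset.nodup_cons.2 ⟨h5, h1⟩, ?_, ?_⟩, Multiset.cons_le_cons _ h4⟩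
      · intro y hy
        rcases Multiset.mem_cons.1 hy with rfl | hy
        · exact hx0
        · exact h2 y hy
      · rw [Multiset.sum_cons, h3, add_comm]
    · intro M hM
      rw [Finset.mem_filter, mem_distinctParts, Multiset.cons_le_of_notMem hx] at hM
      obtain ⟨⟨h1, h2, h3⟩, h4, h5⟩ := hM
      rw [Finset.mem_filter, mem_distinctParts]
      refine ⟨⟨h1.erase x, fun y hy => h2 y (Multiset.mem_of_mem_erase hy), ?_⟩, ?_,
        fun h => (h1.mem_erase_iff.1 h).1 rfl⟩
      · have := Multiset.sum_erase h4
        omega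
      · rw [Multiset.le_iff_count] at h5 ⊢
        intro y
        by_cases hy : y = x
        · subst hy
          rw [Multiset.count_eq_zero_of_notMem hx]
          exact Nat.zero_le _
        · rw [Multiset.count_erase_of_ne hy]
          exact h5 y
    · intro M hM
      exact Multiset.erase_cons_head _ _
    · intro M hM
      rw [Finset.mem_filter, Multiset.cons_le_of_notMem hx] at hM
      exact Multiset.cons_erase hM.2.1
  · congr 1
    ext M
    simp only [Finset.mem_filter, Multiset.cons_le_of_notMem hx, not_not]
    tauto

lemma card_distinctParts_mem_le {n x : ℕ} (hx0 : 0 < x) (hx : x ≤ n) :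
    ((distinctParts n).filter (x ∈ ·)).card ≤ (distinctParts (n - x)).card := by
  have := card_distinctParts_cons (U := 0) (Multiset.notMem_zero x) hx0 (n - x)
  simp only [Multiset.cons_zero, Multiset.singleton_le, Multiset.zero_le, Finset.filter_true,
    Nat.sub_add_cancel hx] at this
  omega

lemma le_of_mem_distinctParts {n x : ℕ} {M : Multiset ℕ} (hM : M ∈ distinctParts n)
    (hx : x ∈ M) : x ≤ n :=
  (mem_distinctParts.1 hM).2.2 ▸ Multiset.le_sum_of_mem hx

lemma sum_card_distinctParts_le (n : ℕ) :
    ∑ M ∈ distinctParts n, M.card ≤ ∑ k ∈ Finset.range (n + 1), (oddParts k).card := by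
  have h1 : ∀ M ∈ distinctParts n, M.card = ∑ x ∈ Finset.Icc 1 n, if x ∈ M then 1 else 0 := by
    intro M hM
    rw [← Finset.card_filter, ← Multiset.toFinset_card_of_nodup (mem_distinctParts.1 hM).1]
    congr 1
    ext x
    simp only [Multiset.mem_toFinset, Finset.mem_filter, Finset.mem_Icc]
    exact ⟨fun h => ⟨⟨(mem_distinctParts.1 hM).2.1 x h, le_of_mem_distinctParts hM h⟩, h⟩,
      fun h => h.2⟩
  rw [Finset.sum_congr rfl h1, Finset.sum_comm]
  simp_rw [← Finset.card_filter]
  calc _ ≤ ∑ x ∈ Finset.Icc 1 n, (oddParts (n - x)).card := by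
        refine Finset.sum_le_sum fun x hx => ?_
        rw [Finset.mem_Icc] at hx
        rw [← card_distinctParts]
        exact card_distinctParts_mem_le hx.1 hx.2
    _ ≤ ∑ x ∈ Finset.range (n + 1), (oddParts (n - x)).card := by
        refine Finset.sum_le_sum_of_subset fun x hx => ?_
        rw [Finset.mem_Icc] at hx
        rw [Finset.mem_range]
        omega
    _ = _ := Finset.sum_range_reflect (fun k => (oddParts k).card) (n + 1)

lemma card_distinctParts_few (n K : ℕ) :
    ((distinctParts n).filter (fun M => M.card ≤ K)).card ≤ (K + 1) * (n + 1) ^ K := by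
  calc _ ≤ ((Finset.range (K + 1)).biUnion
        fun j => (Finset.range (n + 1)).powersetCard j).card := by
        refine Finset.card_le_card_of_injOn Multiset.toFinset ?_ ?_
        · intro M hM
          rw [Finset.mem_coe, Finset.mem_filter] at hM
          simp only [Finset.coe_biUnion, Set.mem_iUnion, Finset.mem_coe, Finset.mem_powersetCard,
            Finset.mem_range]
          refine ⟨M.card, by omega, fun x hx => ?_,
            Multiset.toFinset_card_of_nodup (mem_distinctParts.1 hM.1).1⟩
          rw [Finset.mem_range, Nat.lt_succ_iff]
          exact le_of_mem_distinctParts hM.1 (Multiset.mem_toFinset.1 hx)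
        · intro M hM N hN h
          rw [Finset.mem_coe, Finset.mem_filter, mem_distinctParts] at hM hN
          have := congrArg Finset.val h
          rwa [Multiset.toFinset_val, Multiset.toFinset_val, hM.1.1.dedup, hN.1.1.dedup] at this
    _ ≤ ∑ j ∈ Finset.range (K + 1), (n + 1) ^ K := by
        refine Finset.card_biUnion_le.trans (Finset.sum_le_sum fun j hj => ?_)
        rw [Finset.card_powersetCard, Finset.card_range]
        rw [Finset.mem_range] at hj
        exact (Nat.choose_le_pow _ _).trans (Nat.pow_le_pow_right (by omega) (by omega))
    _ = _ := by simp

lemma two_pow_sqrt_le (n : ℕ) :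
    2 ^ n.sqrt ≤ ∑ k ∈ Finset.range (n + 1), (oddParts k).card := by
  have h0 : (Finset.Icc 1 n.sqrt).powerset.card = 2 ^ n.sqrt := by simp
  rw [← h0, Finset.card_eq_sum_card_fiberwise (f := fun A => ∑ x ∈ A, x)
    (t := Finset.range (n + 1))]
  · refine Finset.sum_le_sum fun k _ => ?_
    rw [← card_distinctParts]
    refine Finset.card_le_card_of_injOn Finset.val ?_ (fun _ _ _ _ h => Finset.val_injective h)
    intro A hA
    rw [Finset.mem_coe, Finset.mem_filter, Finset.mem_powerset] at hA
    rw [Finset.mem_coe, mem_distinctParts]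
    refine ⟨A.nodup, fun x hx => (Finset.mem_Icc.1 (hA.1 hx)).1, ?_⟩
    rw [← hA.2, Finset.sum_val]
    rfl
  · intro A hA
    rw [Finset.mem_coe, Finset.mem_powerset] at hA
    rw [Finset.mem_coe, Finset.mem_range, Nat.lt_succ_iff]
    calc ∑ x ∈ A, x ≤ ∑ x ∈ Finset.Icc 1 n.sqrt, x := Finset.sum_le_sum_of_subset hA
      _ ≤ ∑ x ∈ Finset.Icc 1 n.sqrt, n.sqrt :=
          Finset.sum_le_sum fun x hx => (Finset.mem_Icc.1 hx).2
      _ = n.sqrt * n.sqrt := by simp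
      _ ≤ n := Nat.sqrt_le n

lemma mul_card_oddParts_le (K n : ℕ) :
    K * (oddParts n).card ≤
      ∑ k ∈ Finset.range (n + 1), (oddParts k).card + K * ((K + 1) * (n + 1) ^ K) := by
  rw [← card_distinctParts, ← Finset.card_filter_add_card_filter_not
    (s := distinctParts n) (fun M => M.card ≤ K), mul_add, add_comm]
  refine add_le_add ?_ (Nat.mul_le_mul_left _ (card_distinctParts_few n K))
  refine le_trans ?_ (sum_card_distinctParts_le n)
  rw [mul_comm, ← smul_eq_mul]
  refine (Finset.card_nsmul_le_sum _ _ K fun M hM => ?_).trans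
    (Finset.sum_le_sum_of_subset (Finset.filter_subset _ _))
  have := (Finset.mem_filter.1 hM).2
  omega

/-- The number of partitions into odd parts of the integers `0, …, n`. -/
noncomputable def oddSum (n : ℕ) : ℝ := ∑ k ∈ Finset.range (n + 1), ((oddParts k).card : ℝ)

/-- The number of partitions of `n - m` into odd parts, and `0` if `n < m`. -/
def oddShift (n m : ℕ) : ℕ := if m ≤ n then (oddParts (n - m)).card else 0

lemma oddShift_antitone (n : ℕ) : Antitone (oddShift n) := by
  intro a b hab
  unfold oddShift
  split_ifs with h1 h2
  · exact card_oddParts_mono (by omega)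
  · omega
  · exact Nat.zero_le _
  · exact le_rfl

lemma two_pow_sqrt_le_oddSum (n : ℕ) : (2 : ℝ) ^ n.sqrt ≤ oddSum n := by
  unfold oddSum
  exact_mod_cast two_pow_sqrt_le n

lemma oddSum_pos (n : ℕ) : 0 < oddSum n := lt_of_lt_of_le (by positivity) (two_pow_sqrt_le_oddSum n)

lemma tendsto_nat_sqrt : Filter.Tendsto Nat.sqrt Filter.atTop Filter.atTop :=
  Filter.tendsto_atTop_atTop.2 fun b => ⟨b * b, fun _ h => Nat.le_sqrt.2 h⟩

lemma tendsto_pow_div_oddSum (K : ℕ) :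
    Filter.Tendsto (fun n : ℕ => ((n : ℝ) + 1) ^ K / oddSum n) Filter.atTop (nhds 0) := by
  have h1 : Filter.Tendsto (fun m : ℕ => (m : ℝ) ^ (2 * K) * (1 / 2 : ℝ) ^ m)
      Filter.atTop (nhds 0) :=
    tendsto_pow_const_mul_const_pow_of_abs_lt_one (2 * K) (by norm_num [abs_of_pos])
  have h2 := ((h1.comp (Filter.tendsto_add_atTop_nat 1)).comp tendsto_nat_sqrt).const_mul 2
  rw [mul_zero] at h2
  refine squeeze_zero (fun n => div_nonneg (by positivity) (oddSum_pos n).le) (fun n => ?_) h2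
  have hn : (n : ℝ) + 1 ≤ ((n.sqrt : ℝ) + 1) ^ 2 := by
    have := Nat.lt_succ_sqrt' n
    exact_mod_cast this
  calc ((n : ℝ) + 1) ^ K / oddSum n ≤ (((n.sqrt : ℝ) + 1) ^ 2) ^ K / 2 ^ n.sqrt :=
        div_le_div₀ (by positivity) (pow_le_pow_left₀ (by positivity) hn K) (by positivity)
          (two_pow_sqrt_le_oddSum n)
    _ = _ := by
        simp only [Function.comp_apply, Nat.cast_add, Nat.cast_one, one_div, inv_pow,
          pow_succ _ n.sqrt]
        rw [← pow_mul, pow_mul]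
        field_simp

lemma tendsto_card_div_oddSum :
    Filter.Tendsto (fun n : ℕ => ((oddParts n).card : ℝ) / oddSum n) Filter.atTop (nhds 0) := by
  rw [Metric.tendsto_atTop]
  intro ε hε
  obtain ⟨K, hK⟩ := exists_nat_gt (2 / ε)
  have hK0 : (0 : ℝ) < K := lt_trans (by positivity) hK
  have h1 := (tendsto_pow_div_oddSum K).const_mul ((K : ℝ) + 1)
  rw [mul_zero] at h1
  obtain ⟨N, hN⟩ := (Metric.tendsto_atTop.1 h1) (ε / 2) (by positivity)
  refine ⟨N, fun n hn => ?_⟩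
  have h2 := hN n hn
  have hS := oddSum_pos n
  have h3 : (K : ℝ) * (oddParts n).card ≤ oddSum n + K * ((K + 1) * ((n : ℝ) + 1) ^ K) := by
    unfold oddSum
    exact_mod_cast mul_card_oddParts_le K n
  rw [Real.dist_eq, sub_zero, abs_of_nonneg (by positivity)] at h2 ⊢
  rw [← mul_div_assoc, div_lt_iff₀ hS] at h2
  rw [div_lt_iff₀ hS]
  have h4 : 2 < K * ε := by rwa [div_lt_iff₀ hε] at hK
  have h5 : (K : ℝ) * (oddParts n).card < K * (ε * oddSum n) := by
    nlinarith [mul_lt_mul_of_pos_left h2 hK0, mul_lt_mul_of_pos_right h4 hS]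
  exact lt_of_mul_lt_mul_left h5 hK0.le

lemma Antitone.sum_range_le_progression {F : ℕ → ℕ} (hF : Antitone F) (c d N : ℕ) :
    ∑ m ∈ Finset.range (c + d * N), F m ≤
      c * F 0 + d * ∑ s ∈ Finset.range N, F (c + d * s) := by
  induction N with
  | zero =>
    have := Finset.sum_le_card_nsmul (Finset.range c) F (F 0) fun x _ => hF (Nat.zero_le x)
    simpa using this
  | succ N ih =>
    rw [Nat.mul_succ, ← add_assoc, Finset.sum_range_add, Finset.sum_range_succ _ N, mul_add]
    have := Finset.sum_le_card_nsmul (Finset.range d) (fun i => F (c + d * N + i))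
      (F (c + d * N)) fun x _ => hF (Nat.le_add_right _ _)
    rw [Finset.card_range, smul_eq_mul] at this
    omega

lemma Antitone.progression_le_sum_range {F : ℕ → ℕ} (hF : Antitone F) (c d N : ℕ) :
    d * ∑ s ∈ Finset.range (N + 1), F (c + d * s) ≤
      d * F 0 + ∑ m ∈ Finset.range (c + d * N), F m := by
  induction N with
  | zero =>
    have := Nat.mul_le_mul_left d (hF (Nat.zero_le c))
    simp
    omega
  | succ N ih =>
    rw [Nat.mul_succ, ← add_assoc, Finset.sum_range_add F, Finset.sum_range_succ _ (N + 1), mul_add]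
    have := Finset.card_nsmul_le_sum (Finset.range d) (fun i => F (c + d * N + i))
      (F (c + d * (N + 1))) fun x hx => hF (by
        rw [Finset.mem_range] at hx
        rw [Nat.mul_succ]
        omega)
    rw [Finset.card_range, smul_eq_mul] at this
    omega

lemma sum_oddShift {n N : ℕ} (hN : n < N) :
    ((∑ m ∈ Finset.range N, oddShift n m : ℕ) : ℝ) = oddSum n := by
  have h : ∑ m ∈ Finset.range N, oddShift n m = ∑ m ∈ Finset.range (n + 1), oddShift n m := by
    symm
    refine Finset.sum_subset (fun x hx => ?_) fun x _ hx => ?_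
    · rw [Finset.mem_range] at *
      omega
    · rw [Finset.mem_range] at hx
      exact if_neg (by omega)
  rw [h, oddSum, ← Nat.cast_sum, ← Finset.sum_range_reflect (fun k => (oddParts k).card) (n + 1)]
  congr 1
  refine Finset.sum_congr rfl fun m hm => ?_
  rw [Finset.mem_range] at hm
  rw [oddShift, if_pos (by omega)]
  congr 2

lemma tendsto_sum_oddShift (c : ℕ) {d : ℕ} (hd : 0 < d) :
    Filter.Tendsto
      (fun n : ℕ => (∑ s ∈ Finset.range (n + 1), (oddShift n (c + d * s) : ℝ)) / oddSum n)
      Filter.atTop (nhds (1 / d)) := by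
  have hd' : (0 : ℝ) < d := by exact_mod_cast hd
  have h0 := tendsto_card_div_oddSum.const_mul (c + d : ℝ)
  rw [mul_zero] at h0
  have key : Filter.Tendsto (fun n : ℕ =>
      (d : ℝ) * ((∑ s ∈ Finset.range (n + 1), (oddShift n (c + d * s) : ℝ)) / oddSum n))
      Filter.atTop (nhds 1) := by
    rw [tendsto_iff_dist_tendsto_zero]
    refine squeeze_zero (fun _ => dist_nonneg) (fun n => ?_) h0
    have hS := oddSum_pos n
    have hn : n ≤ d * n := Nat.le_mul_of_pos_left n hd
    have a1 := (oddShift_antitone n).sum_range_le_progression c d (n + 1)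
    have a2 := (oddShift_antitone n).progression_le_sum_range c d (n + 1)
    rw [Finset.sum_range_succ, mul_add] at a2
    have e1 := sum_oddShift (n := n) (N := c + d * (n + 1)) (by rw [Nat.mul_succ]; omega)
    have e0 : oddShift n 0 = (oddParts n).card := by simp [oddShift]
    rw [e0] at a1 a2
    have b1 : oddSum n ≤ c * (oddParts n).card +
        d * ∑ s ∈ Finset.range (n + 1), (oddShift n (c + d * s) : ℝ) := by
      rw [← e1]
      exact_mod_cast a1
    have b2 : d * ∑ s ∈ Finset.range (n + 1), (oddShift n (c + d * s) : ℝ) ≤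
        d * (oddParts n).card + oddSum n := by
      rw [← e1]
      exact_mod_cast le_trans (Nat.le_add_right _ _) a2
    rw [Real.dist_eq, ← mul_div_assoc, ← mul_div_assoc, div_sub_one hS.ne', abs_div,
      abs_of_pos hS]
    refine div_le_div_of_nonneg_right ?_ hS.le
    have p1 : (0 : ℝ) ≤ c * (oddParts n).card := by positivity
    have p2 : (0 : ℝ) ≤ d * (oddParts n).card := by positivity
    rw [abs_le]
    constructor <;> linarith
  have := key.const_mul (1 / (d : ℝ))
  simp only [mul_one] at this
  refine this.congr fun n => ?_
  rw [← mul_assoc, one_div_mul_cancel hd'.ne', one_mul]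

lemma vertInd_zero (M : Multiset ℕ) (p : ℕ) : vertInd M 0 p 0 = 0 := rfl

lemma vertInd_succ (M : Multiset ℕ) (r p k : ℕ) :
    vertInd M (r + 1) p k =
      if k < M.count p then vertInd M r p (k + 1) else vertInd M r (p + 1) 0 := by
  unfold vertInd
  rw [Function.iterate_succ_apply, pathStep]
  by_cases h : k < M.count p <;> simp [h]

lemma vertInd_one (M : Multiset ℕ) (p k : ℕ) :
    vertInd M 1 p k = if k < M.count p then 1 else 0 := by
  rw [vertInd_succ]
  rfl

lemma filter_cons_le (F : Finset (Multiset ℕ)) (U : Multiset ℕ) (q : ℕ) :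
    F.filter (q ::ₘ U ≤ ·) = (F.filter (U ≤ ·)).filter (U.count q < Multiset.count q ·) := by
  ext M
  simp only [Finset.mem_filter, and_assoc]
  refine and_congr_right fun _ => ⟨fun h => ⟨(Multiset.le_cons_self _ _).trans h, ?_⟩, ?_⟩
  · have := Multiset.le_iff_count.1 h q
    rwa [Multiset.count_cons_self] at this
  · rintro ⟨h1, h2⟩
    rw [Multiset.le_iff_count] at h1 ⊢
    intro y
    by_cases hy : y = q
    · subst hy
      rwa [Multiset.count_cons_self]
    · rw [Multiset.count_cons_of_ne hy]
      exact h1 y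

/-- The partial geometric sum `1 - x + x ^ 2 - ⋯` with `r` terms. -/
noncomputable def altGeom (r : ℕ) (x : ℝ) : ℝ := ∑ i ∈ Finset.range r, (-x) ^ i

lemma altGeom_add_two (r : ℕ) (x : ℝ) :
    altGeom (r + 2) x = (1 - x) * altGeom (r + 1) x + x * altGeom r x := by
  simp only [altGeom, Finset.sum_range_succ, pow_succ]
  ring

lemma one_add_mul_altGeom (r : ℕ) (x : ℝ) : (1 + x) * altGeom r x = 1 - (-x) ^ r := by
  have := mul_neg_geom_sum (-x) r
  rwa [sub_neg_eq_add] at this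

lemma continuous_altGeom (r : ℕ) : Continuous (altGeom r) := by
  unfold altGeom
  fun_prop

lemma uIcc_zero_one_pos {z : ℝ} (hz : z ∈ Set.uIcc (0 : ℝ) 1) : 0 < 1 + z := by
  rw [Set.uIcc_of_le zero_le_one] at hz
  linarith [hz.1]

lemma intervalIntegrable_div_one_add_pow {f : ℝ → ℝ} (hf : Continuous f) (k : ℕ) :
    IntervalIntegrable (fun z => f z / (1 + z) ^ k) MeasureTheory.volume 0 1 := by
  refine ContinuousOn.intervalIntegrable ?_
  exact hf.continuousOn.div (by fun_prop) fun z hz => (pow_pos (uIcc_zero_one_pos hz) k).ne'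

/-- The limiting frequency of `k` prescribed nearby parts, weighted by `z ^ l`, among partitions
into distinct parts. -/
noncomputable def distinctMoment (l k : ℕ) : ℝ := ∫ z in (0 : ℝ)..1, z ^ (l + k - 1) / (1 + z) ^ k

lemma distinctMoment_zero {l : ℕ} (hl : 0 < l) : distinctMoment l 0 = 1 / l := by
  obtain ⟨l, rfl⟩ : ∃ m, l = m + 1 := ⟨l - 1, by omega⟩
  simp [distinctMoment, integral_pow]

lemma distinctMoment_succ (l k : ℕ) (h : 0 < l + 1 + k) :
    distinctMoment l (k + 1) = distinctMoment (l + 1) k - distinctMoment (l + 1) (k + 1) := by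
  unfold distinctMoment
  rw [← intervalIntegral.integral_sub (intervalIntegrable_div_one_add_pow (by fun_prop) _)
    (intervalIntegrable_div_one_add_pow (by fun_prop) _)]
  refine intervalIntegral.integral_congr fun z hz => ?_
  have := (uIcc_zero_one_pos hz).ne'
  simp only [show l + (k + 1) - 1 = l + k by omega, show l + 1 + k - 1 = l + k by omega,
    show l + 1 + (k + 1) - 1 = l + k + 1 by omega]
  field_simp
  ring

lemma distinctMoment_nonneg (l k : ℕ) : 0 ≤ distinctMoment l k := by
  refine intervalIntegral.integral_nonneg zero_le_one fun z hz => ?_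
  have := hz.1
  positivity

lemma distinctMoment_le {l : ℕ} (hl : 0 < l) (k : ℕ) : distinctMoment l k ≤ 1 / l := by
  rw [← distinctMoment_zero hl]
  refine intervalIntegral.integral_mono_on zero_le_one
    (intervalIntegrable_div_one_add_pow (by fun_prop) _)
    (intervalIntegrable_div_one_add_pow (by fun_prop) _) fun z hz => ?_
  have h0 := hz.1
  rw [pow_zero, div_one]
  refine (div_le_self (by positivity) (one_le_pow₀ (by linarith))).trans ?_
  exact pow_le_pow_of_le_one h0 hz.2 (by omega)

/-- The number of partitions of `n - m` into distinct parts containing `U`, and `0` if `n < m`. -/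
def distinctShift (U : Multiset ℕ) (n m : ℕ) : ℕ :=
  if m ≤ n then ((distinctParts (n - m)).filter (U ≤ ·)).card else 0

lemma distinctShift_cons {U : Multiset ℕ} {x : ℕ} (hx : x ∉ U) (hx0 : 0 < x) (n m : ℕ) :
    distinctShift (x ::ₘ U) n m + distinctShift (x ::ₘ U) n (m + x) =
      distinctShift U n (m + x) := by
  unfold distinctShift
  by_cases h1 : m + x ≤ n
  · rw [if_pos h1, if_pos (by omega), if_pos h1,
      ← card_distinctParts_cons hx hx0 (n - (m + x))]
    congr 5
    omega
  · rw [if_neg h1, if_neg h1, add_zero]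
    split_ifs with h2
    · rw [Finset.card_eq_zero]
      refine Finset.filter_eq_empty_iff.2 fun M hM hle => h1 ?_
      have := le_of_mem_distinctParts hM (Multiset.mem_of_le hle (Multiset.mem_cons_self x U))
      omega
    · rfl

lemma distinctShift_le (U : Multiset ℕ) (n m : ℕ) : distinctShift U n m ≤ oddShift n m := by
  unfold distinctShift oddShift
  split_ifs
  · rw [← card_distinctParts]
    exact Finset.card_filter_le _ _
  · exact le_rfl

/-- The total of `distinctShift` over the translates of `T`. -/
def distinctTotal (T : Multiset ℕ) (l c n : ℕ) : ℕ :=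
  ∑ p ∈ Finset.range (n + 1), distinctShift (T.map (· + (p + 1))) n (c + l * p)

lemma distinctTotal_cons {T : Multiset ℕ} {x : ℕ} (hx : x ∉ T) (l c n : ℕ) :
    distinctTotal (x ::ₘ T) l c n + distinctTotal (x ::ₘ T) (l + 1) (c + x + 1) n =
      distinctTotal T (l + 1) (c + x + 1) n := by
  unfold distinctTotal
  rw [← Finset.sum_add_distrib]
  refine Finset.sum_congr rfl fun p _ => ?_
  rw [Multiset.map_cons, show c + x + 1 + (l + 1) * p = c + l * p + (x + (p + 1)) by ring]
  refine distinctShift_cons ?_ (by omega) _ _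
  rw [Multiset.mem_map]
  rintro ⟨y, hy, hyx⟩
  exact hx ((show y = x by omega) ▸ hy)

lemma distinctTotal_le (T : Multiset ℕ) (l c n : ℕ) :
    (distinctTotal T l c n : ℝ) ≤ ∑ p ∈ Finset.range (n + 1), (oddShift n (c + l * p) : ℝ) := by
  unfold distinctTotal
  push_cast
  exact Finset.sum_le_sum fun p _ => by exact_mod_cast distinctShift_le _ _ _

lemma tendsto_distinctTotal (T : Multiset ℕ) (hT : T.Nodup) :
    ∀ l c : ℕ, 0 < l + T.card →
      Filter.Tendsto (fun n => (distinctTotal T l c n : ℝ) / oddSum n) Filter.atTop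
        (nhds (distinctMoment l T.card)) := by
  induction T using Multiset.induction_on with
  | empty =>
    intro l c hl
    rw [Multiset.card_zero, add_zero] at hl
    rw [Multiset.card_zero, distinctMoment_zero hl]
    refine (tendsto_sum_oddShift c hl).congr fun n => ?_
    simp [distinctTotal, distinctShift, oddShift, card_distinctParts]
  | cons x T ih =>
    rw [Multiset.nodup_cons] at hT
    specialize ih hT.2
    have approx : ∀ d l c : ℕ, 0 < l + d → ∀ ε : ℝ, 2 / ((l + d : ℕ) : ℝ) < ε →
        ∀ᶠ n in Filter.atTop, |(distinctTotal (x ::ₘ T) l c n : ℝ) / oddSum n -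
          distinctMoment l (T.card + 1)| < ε := by
      intro d
      induction d with
      | zero =>
        intro l c hl ε hε
        rw [add_zero] at hl hε
        have hl' : (0 : ℝ) < l := by exact_mod_cast hl
        have h2 : (2 : ℝ) / l = 1 / l + 1 / l := by ring
        have h1 : (1 : ℝ) / l < ε - 1 / l := by linarith
        filter_upwards [(tendsto_sum_oddShift c hl).eventually_lt_const h1] with n hn
        have a1 := div_le_div_of_nonneg_right (distinctTotal_le (x ::ₘ T) l c n) (oddSum_pos n).le
        have a2 : 0 ≤ (distinctTotal (x ::ₘ T) l c n : ℝ) / oddSum n :=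
          div_nonneg (Nat.cast_nonneg _) (oddSum_pos n).le
        have a3 := distinctMoment_nonneg l (T.card + 1)
        have a4 := distinctMoment_le hl (T.card + 1)
        have a5 : 0 < 1 / (l : ℝ) := by positivity
        rw [abs_lt]
        constructor <;> linarith
      | succ d ihd =>
        intro l c hl ε hε
        obtain ⟨δ, hδ1, hδ2⟩ := exists_between hε
        have b1 := ihd (l + 1) (c + x + 1) (by omega) δ (by
          rwa [show l + 1 + d = l + (d + 1) by ring])
        have b2 := (Metric.tendsto_nhds.1 (ih (l + 1) (c + x + 1) (by omega))) (ε - δ)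
          (by linarith)
        filter_upwards [b1, b2] with n h1 h2
        rw [Real.dist_eq] at h2
        have e := congrArg (fun t : ℕ => (t : ℝ) / oddSum n) (distinctTotal_cons hT.1 l c n)
        simp only [Nat.cast_add, add_div] at e
        have e2 := distinctMoment_succ l T.card (by omega)
        rw [abs_lt] at h1 h2 ⊢
        constructor <;> linarith [h1.1, h1.2, h2.1, h2.2]
    intro l c _
    rw [Multiset.card_cons, Metric.tendsto_nhds]
    intro ε hε
    obtain ⟨d, hd⟩ := exists_nat_gt (2 / ε)
    have hd0 : (0 : ℝ) < d := lt_trans (by positivity) hd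
    refine approx d l c (by
      have : 0 < d := by exact_mod_cast hd0
      omega) ε ?_
    rw [div_lt_iff₀ hε] at hd
    have : (d : ℝ) ≤ ((l + d : ℕ) : ℝ) := by push_cast; linarith [(Nat.cast_nonneg l : (0 : ℝ) ≤ l)]
    rw [div_lt_iff₀ (by linarith)]
    nlinarith

/-- The total number of translates of `T` contained in a partition of `n` into distinct parts such
that the boundary path started `i` above the base of the translate is vertical at step `r`. -/
def distinctVert (r : ℕ) (T : Multiset ℕ) (i n : ℕ) : ℕ :=
  ∑ p ∈ Finset.range (n + 1), ∑ M ∈ (distinctParts n).filter (T.map (· + (p + 1)) ≤ ·),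
    vertInd M r (p + 1 + i) 0

/-- The limiting value of `distinctVert r T i n`, where `k` is the size of `T`. -/
noncomputable def distinctVertLim (r k : ℕ) : ℝ :=
  ∫ z in (0 : ℝ)..1, z ^ k * altGeom r (z / (1 + z)) / (1 + z) ^ (k + 1)

lemma intervalIntegrable_distinctVertLim (r k : ℕ) :
    IntervalIntegrable (fun z => z ^ k * altGeom r (z / (1 + z)) / (1 + z) ^ (k + 1))
      MeasureTheory.volume 0 1 := by
  refine ContinuousOn.intervalIntegrable ?_
  refine ContinuousOn.div (ContinuousOn.mul (by fun_prop) ?_) (by fun_prop)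
    fun z hz => (pow_pos (uIcc_zero_one_pos hz) _).ne'
  exact (continuous_altGeom r).comp_continuousOn
    (continuousOn_id.div (by fun_prop) fun z hz => (uIcc_zero_one_pos hz).ne')

lemma distinctVertLim_add_two (r k : ℕ) :
    distinctVertLim (r + 2) k = distinctVertLim (r + 1) k - distinctVertLim (r + 1) (k + 1) +
      distinctVertLim r (k + 1) := by
  unfold distinctVertLim
  rw [← intervalIntegral.integral_sub (intervalIntegrable_distinctVertLim _ _)
    (intervalIntegrable_distinctVertLim _ _), ← intervalIntegral.integral_add
    ((intervalIntegrable_distinctVertLim _ _).sub (intervalIntegrable_distinctVertLim _ _))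
    (intervalIntegrable_distinctVertLim _ _)]
  refine intervalIntegral.integral_congr fun z hz => ?_
  have := (uIcc_zero_one_pos hz).ne'
  simp only [altGeom_add_two]
  field_simp
  ring

lemma notMem_map_add {T : Multiset ℕ} {i b : ℕ} (h : ∀ x ∈ T, x < i) :
    b + i ∉ T.map (· + b) := by
  rw [Multiset.mem_map]
  rintro ⟨y, hy, hyx⟩
  have := h y hy
  omega

lemma distinctVert_one {T : Multiset ℕ} {i : ℕ} (hi : ∀ x ∈ T, x < i) (n : ℕ) :
    distinctVert 1 T i n = distinctTotal (i ::ₘ T) 0 0 n := by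
  unfold distinctVert distinctTotal
  refine Finset.sum_congr rfl fun p _ => ?_
  simp only [vertInd_one]
  rw [← Finset.card_filter, distinctShift, if_pos (by omega), Multiset.map_cons,
    add_comm i (p + 1), filter_cons_le, Multiset.count_eq_zero_of_notMem (notMem_map_add hi)]
  simp

lemma distinctVert_add_two {T : Multiset ℕ} {i : ℕ} (hi : ∀ x ∈ T, x < i) (r n : ℕ) :
    distinctVert (r + 2) T i n + distinctVert (r + 1) (i ::ₘ T) (i + 1) n =
      distinctVert (r + 1) T (i + 1) n + distinctVert r (i ::ₘ T) (i + 1) n := by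
  unfold distinctVert
  rw [← Finset.sum_add_distrib, ← Finset.sum_add_distrib]
  refine Finset.sum_congr rfl fun p _ => ?_
  rw [Multiset.map_cons, add_comm i (p + 1), filter_cons_le,
    Multiset.count_eq_zero_of_notMem (notMem_map_add hi),
    Finset.sum_filter (fun M => 0 < Multiset.count (p + 1 + i) M),
    Finset.sum_filter (fun M => 0 < Multiset.count (p + 1 + i) M),
    ← Finset.sum_add_distrib, ← Finset.sum_add_distrib]
  refine Finset.sum_congr rfl fun M hM => ?_
  have hM := Multiset.nodup_iff_count_le_one.1
    (mem_distinctParts.1 (Finset.mem_filter.1 hM).1).1 (p + 1 + i)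
  rw [vertInd_succ M (r + 1)]
  by_cases h : 0 < Multiset.count (p + 1 + i) M
  · simp only [h, if_true]
    rw [vertInd_succ M r (p + 1 + i), if_neg (by omega)]
    ring_nf
  · simp only [h, if_false]
    ring_nf

lemma tendsto_distinctVert (r : ℕ) : ∀ (T : Multiset ℕ) (i : ℕ), T.Nodup → (∀ x ∈ T, x < i) →
    Filter.Tendsto (fun n => (distinctVert r T i n : ℝ) / oddSum n) Filter.atTop
      (nhds (distinctVertLim r T.card)) := by
  induction r using Nat.strong_induction_on with
  | _ r ih =>
    intro T i hT hi
    match r with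
    | 0 =>
      simp [distinctVert, vertInd_zero, distinctVertLim, altGeom]
    | 1 =>
      have hlim : distinctVertLim 1 T.card = distinctMoment 0 (T.card + 1) := by
        unfold distinctVertLim distinctMoment
        refine intervalIntegral.integral_congr fun z _ => ?_
        simp [altGeom]
      rw [hlim]
      simp_rw [distinctVert_one hi]
      rw [← Multiset.card_cons i T]
      refine tendsto_distinctTotal _ (Multiset.nodup_cons.2 ⟨fun h => ?_, hT⟩) _ _ (by simp)
      exact (hi i h).false
    | r + 2 =>
      have hT' : (i ::ₘ T).Nodup := Multiset.nodup_cons.2 ⟨fun h => (hi i h).false, hT⟩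
      have hi1 : ∀ x ∈ T, x < i + 1 := fun x hx => (hi x hx).trans (Nat.lt_succ_self i)
      have hi2 : ∀ x ∈ i ::ₘ T, x < i + 1 := by
        intro x hx
        rcases Multiset.mem_cons.1 hx with rfl | hx
        · exact Nat.lt_succ_self _
        · exact hi1 x hx
      have h1 := ih (r + 1) (by omega) T (i + 1) hT hi1
      have h2 := ih (r + 1) (by omega) (i ::ₘ T) (i + 1) hT' hi2
      have h3 := ih r (by omega) (i ::ₘ T) (i + 1) hT' hi2
      rw [Multiset.card_cons] at h2 h3
      rw [distinctVertLim_add_two]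
      refine ((h1.sub h2).add h3).congr fun n => ?_
      have e := congrArg (fun t : ℕ => (t : ℝ) / oddSum n) (distinctVert_add_two hi r n)
      simp only [Nat.cast_add, add_div] at e
      linarith

lemma hookDistinct_eq_distinctVert (h n : ℕ) : hookDistinct h n = distinctVert h 0 0 n := by
  rw [hookDistinct_eq, Finset.sum_comm]
  simp [distinctVert]

/-- The total number of translates of `T` by odd integers contained in a partition of `n` into odd
parts such that the boundary path, started `i` above the base of the translate, is vertical at
step `r`. -/
def oddVert (r : ℕ) (T : Multiset ℕ) (i n : ℕ) : ℕ :=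
  ∑ s ∈ Finset.range (n + 1), ∑ M ∈ (oddParts n).filter (T.map (· + (2 * s + 1)) ≤ ·),
    vertInd M r (2 * s + 1 + i) (T.count i)

/-- The limiting value of `oddVert r T i n`, where `k` is the size of `T`. -/
noncomputable def oddVertLim (r k : ℕ) : ℝ :=
  1 / 2 * ∫ s in (0 : ℝ)..1, (1 - s) ^ k * altGeom r s

lemma intervalIntegrable_oddVertLim (r k : ℕ) :
    IntervalIntegrable (fun s => (1 - s) ^ k * altGeom r s) MeasureTheory.volume 0 1 := by
  refine Continuous.intervalIntegrable ?_ _ _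
  have := continuous_altGeom r
  fun_prop

lemma oddVertLim_one (k : ℕ) : oddVertLim 1 k = 1 / ((2 * (k + 1) : ℕ) : ℝ) := by
  have h := intervalIntegral.integral_comp_sub_left (fun x : ℝ => x ^ k) (1 : ℝ) (a := 0) (b := 1)
  simp only [sub_self, sub_zero, integral_pow] at h
  simp only [oddVertLim, altGeom, Finset.sum_range_one, pow_zero, mul_one, h]
  push_cast
  field_simp
  simp

lemma oddVertLim_add_two (r k : ℕ) :
    oddVertLim (r + 2) k =
      oddVertLim (r + 1) (k + 1) + oddVertLim r k - oddVertLim r (k + 1) := by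
  unfold oddVertLim
  rw [← mul_add, ← mul_sub, ← intervalIntegral.integral_add (intervalIntegrable_oddVertLim _ _)
    (intervalIntegrable_oddVertLim _ _), ← intervalIntegral.integral_sub
    ((intervalIntegrable_oddVertLim _ _).add (intervalIntegrable_oddVertLim _ _))
    (intervalIntegrable_oddVertLim _ _)]
  congr 1
  refine intervalIntegral.integral_congr fun s _ => ?_
  simp only [altGeom_add_two]
  ring

lemma count_map_add (T : Multiset ℕ) (b i : ℕ) :
    (T.map (· + b)).count (b + i) = T.count i := by
  rw [add_comm b i]
  exact Multiset.count_map_eq_count' (· + b) T (add_left_injective b) i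

lemma oddVert_one {T : Multiset ℕ} {i : ℕ} (hT : ∀ x ∈ T, Even x) (hi : Even i) (n : ℕ) :
    oddVert 1 T i n = ∑ s ∈ Finset.range (n + 1),
      oddShift n ((i ::ₘ T).sum + (T.card + 1) + (2 * (T.card + 1)) * s) := by
  unfold oddVert
  refine Finset.sum_congr rfl fun s _ => ?_
  simp only [vertInd_one]
  rw [← Finset.card_filter, ← count_map_add T (2 * s + 1) i, ← filter_cons_le,
    add_comm _ i, ← Multiset.map_cons (· + (2 * s + 1)), card_oddParts_filter_le]
  · have : ((i ::ₘ T).map (· + (2 * s + 1))).sum =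
        (i ::ₘ T).sum + (T.card + 1) + (2 * (T.card + 1)) * s := by
      rw [Multiset.sum_map_add, Multiset.map_id', Multiset.map_const', Multiset.sum_replicate,
        Multiset.card_cons, smul_eq_mul]
      ring
    rw [this, oddShift]
  · intro x hx
    obtain ⟨y, hy, rfl⟩ := Multiset.mem_map.1 hx
    have hy' : Even y := by
      rcases Multiset.mem_cons.1 hy with rfl | hy
      · exact hi
      · exact hT y hy
    exact hy'.add_odd (odd_two_mul_add_one s)

lemma oddVert_add_two {T : Multiset ℕ} {i : ℕ} (hT : ∀ x ∈ T, x ≤ i) (hi : Even i) (r n : ℕ) :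
    oddVert (r + 2) T i n + oddVert r (i ::ₘ T) (i + 2) n =
      oddVert (r + 1) (i ::ₘ T) i n + oddVert r T (i + 2) n := by
  have h0 : T.count (i + 2) = 0 := Multiset.count_eq_zero_of_notMem fun h => by
    have := hT _ h
    omega
  unfold oddVert
  rw [← Finset.sum_add_distrib, ← Finset.sum_add_distrib]
  refine Finset.sum_congr rfl fun s _ => ?_
  rw [Multiset.map_cons, add_comm i (2 * s + 1), filter_cons_le, count_map_add,
    Multiset.count_cons_self, Multiset.count_cons_of_ne (by omega), h0,
    Finset.sum_filter (fun M => T.count i < Multiset.count (2 * s + 1 + i) M),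
    Finset.sum_filter (fun M => T.count i < Multiset.count (2 * s + 1 + i) M),
    ← Finset.sum_add_distrib, ← Finset.sum_add_distrib]
  refine Finset.sum_congr rfl fun M hM => ?_
  have hc : Multiset.count (2 * s + 1 + i + 1) M = 0 := Multiset.count_eq_zero_of_notMem fun h => by
    have := (mem_oddParts.1 (Finset.mem_filter.1 hM).1).1 _ h
    rw [Nat.odd_iff] at this
    rw [Nat.even_iff] at hi
    omega
  rw [vertInd_succ M (r + 1), vertInd_succ M r (2 * s + 1 + i + 1), hc]
  by_cases h : T.count i < Multiset.count (2 * s + 1 + i) M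
  · simp only [h, if_true]
  · simp only [h, if_false, lt_irrefl]
    ring_nf

lemma tendsto_oddVert (r : ℕ) : ∀ (T : Multiset ℕ) (i : ℕ), (∀ x ∈ T, x ≤ i) →
    (∀ x ∈ T, Even x) → Even i → (r = 0 → i ∉ T) →
    Filter.Tendsto (fun n => (oddVert r T i n : ℝ) / oddSum n) Filter.atTop
      (nhds (oddVertLim r T.card)) := by
  induction r using Nat.strong_induction_on with
  | _ r ih =>
    intro T i hle hT hi h0
    match r with
    | 0 =>
      simp [oddVert, Multiset.count_eq_zero_of_notMem (h0 rfl), vertInd_zero, oddVertLim, altGeom]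
    | 1 =>
      rw [oddVertLim_one]
      simp_rw [oddVert_one hT hi, Nat.cast_sum]
      exact tendsto_sum_oddShift _ (by omega)
    | r + 2 =>
      have hT' : ∀ x ∈ i ::ₘ T, Even x := by
        intro x hx
        rcases Multiset.mem_cons.1 hx with rfl | hx
        · exact hi
        · exact hT x hx
      have hle' : ∀ x ∈ i ::ₘ T, x ≤ i := by
        intro x hx
        rcases Multiset.mem_cons.1 hx with rfl | hx
        · exact le_rfl
        · exact hle x hx
      have hi2 : Even (i + 2) := hi.add even_two
      have h1 := ih (r + 1) (by omega) (i ::ₘ T) i hle' hT' hi (by omega)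
      have h2 := ih r (by omega) T (i + 2) (fun x hx => (hle x hx).trans (by omega)) hT hi2
        (fun _ h => by have := hle _ h; omega)
      have h3 := ih r (by omega) (i ::ₘ T) (i + 2) (fun x hx => (hle' x hx).trans (by omega)) hT'
        hi2 (fun _ h => by have := hle' _ h; omega)
      rw [Multiset.card_cons] at h1 h3
      rw [oddVertLim_add_two]
      refine ((h1.add h2).sub h3).congr fun n => ?_
      have e := congrArg (fun t : ℕ => (t : ℝ) / oddSum n) (oddVert_add_two hle hi r n)
      simp only [Nat.cast_add, add_div] at e
      linarith

lemma vertInd_eq_zero {M : Multiset ℕ} {n : ℕ} (hM : ∀ x ∈ M, x ≤ n) (r : ℕ) :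
    ∀ p, n < p → vertInd M r p 0 = 0 := by
  induction r with
  | zero => exact fun p _ => rfl
  | succ r ih =>
    intro p hp
    rw [vertInd_succ, Multiset.count_eq_zero_of_notMem fun h => (hM p h).not_gt hp,
      if_neg (lt_irrefl 0)]
    exact ih _ (hp.trans (Nat.lt_succ_self p))

lemma sum_range_two_mul (f : ℕ → ℕ) (N : ℕ) :
    ∑ j ∈ Finset.range (2 * N), f j = ∑ s ∈ Finset.range N, (f (2 * s) + f (2 * s + 1)) := by
  induction N with
  | zero => simp
  | succ N ih =>
    rw [Nat.mul_succ, Finset.sum_range_succ, Finset.sum_range_succ, ih, Finset.sum_range_succ,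
      add_assoc]

lemma hookOdd_eq_oddVert (r n : ℕ) :
    hookOdd (r + 1) n = oddVert (r + 1) 0 0 n + oddVert r 0 2 n := by
  rw [hookOdd_eq, oddVert, oddVert, ← Finset.sum_add_distrib]
  simp only [Multiset.map_zero, Multiset.zero_le, Finset.filter_true, Multiset.count_zero]
  simp_rw [← Finset.sum_add_distrib]
  rw [Finset.sum_comm (s := Finset.range (n + 1))]
  refine Finset.sum_congr rfl fun M hM => ?_
  rw [mem_oddParts] at hM
  have hle : ∀ x ∈ M, x ≤ n := fun x hx => hM.2 ▸ Multiset.le_sum_of_mem hx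
  have hext : ∑ j ∈ Finset.range (n + 1), vertInd M (r + 1) (j + 1) 0 =
      ∑ j ∈ Finset.range (2 * (n + 1)), vertInd M (r + 1) (j + 1) 0 := by
    refine Finset.sum_subset (fun x hx => ?_) fun x _ hx => ?_
    · rw [Finset.mem_range] at *
      omega
    · rw [Finset.mem_range] at hx
      exact vertInd_eq_zero hle _ _ (by omega)
  rw [hext, sum_range_two_mul]
  refine Finset.sum_congr rfl fun s _ => ?_
  have hc : M.count (2 * s + 1 + 1) = 0 := Multiset.count_eq_zero_of_notMem fun h => by
    have := hM.1 _ h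
    rw [Nat.odd_iff] at this
    omega
  rw [vertInd_succ M r (2 * s + 1 + 1), hc, if_neg (lt_irrefl 0)]

lemma tendsto_hookDistinct (h : ℕ) :
    Filter.Tendsto (fun n => (hookDistinct h n : ℝ) / oddSum n) Filter.atTop
      (nhds (distinctVertLim h 0)) := by
  simp_rw [hookDistinct_eq_distinctVert]
  exact tendsto_distinctVert h 0 0 Multiset.nodup_zero (by simp)

lemma tendsto_hookOdd (r : ℕ) :
    Filter.Tendsto (fun n => (hookOdd (r + 1) n : ℝ) / oddSum n) Filter.atTop
      (nhds (oddVertLim (r + 1) 0 + oddVertLim r 0)) := by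
  simp_rw [hookOdd_eq_oddVert, Nat.cast_add, add_div]
  exact (tendsto_oddVert (r + 1) 0 0 (by simp) (by simp) Even.zero (by simp)).add
    (tendsto_oddVert r 0 2 (by simp) (by simp) even_two (by simp))

lemma integral_inv_one_add : ∫ s in (0 : ℝ)..1, 1 / (1 + s) = Real.log 2 := by
  have h := intervalIntegral.integral_comp_add_left (fun x : ℝ => 1 / x) (1 : ℝ) (a := 0) (b := 1)
  rw [h, integral_one_div_of_pos (by norm_num) (by norm_num)]
  norm_num

lemma integral_inv_one_add_two_mul :
    ∫ z in (0 : ℝ)..1, 1 / (1 + 2 * z) = Real.log 3 / 2 := by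
  have h := intervalIntegral.integral_comp_add_mul (fun x : ℝ => 1 / x) (a := 0) (b := 1)
    (two_ne_zero' ℝ) 1
  rw [h, integral_one_div_of_pos (by norm_num) (by norm_num)]
  norm_num
  ring

lemma altGeom_eq_sub {s : ℝ} (hs : 0 ≤ s) (r : ℕ) :
    altGeom r s = 1 / (1 + s) - (-s) ^ r / (1 + s) := by
  rw [← sub_div, ← one_add_mul_altGeom, mul_div_cancel_left₀]
  positivity

lemma intervalIntegrable_inv_one_add :
    IntervalIntegrable (fun s : ℝ => 1 / (1 + s)) MeasureTheory.volume 0 1 := by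
  simpa using intervalIntegrable_div_one_add_pow (continuous_const (y := (1 : ℝ))) 1

lemma intervalIntegrable_inv_one_add_two_mul :
    IntervalIntegrable (fun z : ℝ => 1 / (1 + 2 * z)) MeasureTheory.volume 0 1 := by
  refine ContinuousOn.intervalIntegrable (continuousOn_const.div (by fun_prop) fun z hz => ?_)
  rw [Set.uIcc_of_le zero_le_one] at hz
  have := hz.1
  positivity

lemma abs_oddVertLim_sub_le (r : ℕ) : |oddVertLim r 0 - Real.log 2 / 2| ≤ 1 / ((r : ℝ) + 1) := by
  have h1 : oddVertLim r 0 - Real.log 2 / 2 =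
      1 / 2 * ∫ s in (0 : ℝ)..1, ((1 - s) ^ 0 * altGeom r s - 1 / (1 + s)) := by
    rw [intervalIntegral.integral_sub (intervalIntegrable_oddVertLim _ _)
      intervalIntegrable_inv_one_add, integral_inv_one_add, oddVertLim]
    ring
  have h2 : ‖∫ s in (0 : ℝ)..1, ((1 - s) ^ 0 * altGeom r s - 1 / (1 + s))‖ ≤
      ∫ s in (0 : ℝ)..1, s ^ r := by
    refine intervalIntegral.norm_integral_le_of_norm_le zero_le_one ?_
      ((continuous_pow r).intervalIntegrable _ _)
    refine Filter.Eventually.of_forall fun s hs => ?_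
    have hs0 := hs.1
    rw [altGeom_eq_sub hs0.le, pow_zero, one_mul, sub_sub_cancel_left, norm_neg, norm_div,
      norm_pow, norm_neg, Real.norm_of_nonneg hs0.le, Real.norm_of_nonneg (by linarith)]
    exact div_le_self (by positivity) (by linarith)
  rw [integral_pow, Real.norm_eq_abs] at h2
  simp only [one_pow, ne_eq, Nat.add_eq_zero_iff, one_ne_zero, and_false, not_false_eq_true,
    zero_pow, sub_zero] at h2
  rw [h1, abs_mul, abs_of_pos (by norm_num : (0 : ℝ) < 1 / 2)]
  linarith [abs_nonneg (∫ s in (0 : ℝ)..1, ((1 - s) ^ 0 * altGeom r s - 1 / (1 + s)))]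

lemma distinct_integrand_eq {z : ℝ} (hz : 0 ≤ z) (r : ℕ) :
    z ^ 0 * altGeom r (z / (1 + z)) / (1 + z) ^ (0 + 1) =
      1 / (1 + 2 * z) - (-(z / (1 + z))) ^ r / (1 + 2 * z) := by
  have h := one_add_mul_altGeom r (z / (1 + z))
  rw [← sub_div, ← h]
  field_simp
  ring

lemma div_one_add_le_half {z : ℝ} (h0 : 0 ≤ z) (h1 : z ≤ 1) : z / (1 + z) ≤ 1 / 2 := by
  rw [div_le_div_iff₀ (by linarith) two_pos]
  linarith

lemma abs_distinctVertLim_sub_le (r : ℕ) :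
    |distinctVertLim r 0 - Real.log 3 / 2| ≤ (1 / 2 : ℝ) ^ r := by
  rw [← integral_inv_one_add_two_mul, distinctVertLim,
    ← intervalIntegral.integral_sub (intervalIntegrable_distinctVertLim _ _)
      intervalIntegrable_inv_one_add_two_mul, ← Real.norm_eq_abs]
  refine (intervalIntegral.norm_integral_le_of_norm_le_const (C := (1 / 2 : ℝ) ^ r)
    fun z hz => ?_).trans (by simp)
  rw [Set.uIoc_of_le zero_le_one] at hz
  have hz0 := hz.1
  have hx : 0 ≤ z / (1 + z) := by positivity
  rw [distinct_integrand_eq hz0.le, sub_sub_cancel_left, norm_neg, norm_div, norm_pow, norm_neg,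
    Real.norm_of_nonneg hx, Real.norm_of_nonneg (by linarith)]
  exact (div_le_self (by positivity) (by linarith)).trans
    (pow_le_pow_left₀ hx (div_one_add_le_half hz0.le hz.2) r)

lemma distinctVertLim_pos {r : ℕ} (hr : 1 ≤ r) : 0 < distinctVertLim r 0 := by
  have h1 := abs_le.1 (abs_distinctVertLim_sub_le r)
  have h2 : (1 / 2 : ℝ) ^ r ≤ (1 / 2) ^ 1 := pow_le_pow_of_le_one (by norm_num) (by norm_num) hr
  linarith [h1.1, Real.log_three_gt_d9]

lemma neg_neg_pow_le_cube {x : ℝ} (h0 : 0 ≤ x) (h1 : x ≤ 1) {r : ℕ} (hr : 2 ≤ r) :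
    -(-x) ^ r ≤ x ^ 3 := by
  rcases Nat.even_or_odd r with he | ho
  · rw [he.neg_pow]
    linarith [pow_nonneg h0 r, pow_nonneg h0 3]
  · rw [ho.neg_pow, neg_neg]
    refine pow_le_pow_of_le_one h0 h1 ?_
    rw [Nat.odd_iff] at ho
    omega

lemma distinctVertLim_le {r : ℕ} (hr : 2 ≤ r) :
    distinctVertLim r 0 ≤ Real.log 3 / 2 + 1 / 24 := by
  have h : ∫ z in (0 : ℝ)..1, (1 / (1 + 2 * z) + 1 / 24) = Real.log 3 / 2 + 1 / 24 := by
    rw [intervalIntegral.integral_add intervalIntegrable_inv_one_add_two_mul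
      intervalIntegrable_const, integral_inv_one_add_two_mul]
    simp
  rw [← h, distinctVertLim]
  refine intervalIntegral.integral_mono_on zero_le_one (intervalIntegrable_distinctVertLim _ _)
    (intervalIntegrable_inv_one_add_two_mul.add intervalIntegrable_const) fun z hz => ?_
  have hz0 := hz.1
  have hz1 := hz.2
  have hx : 0 ≤ z / (1 + z) := by positivity
  have h1 := neg_neg_pow_le_cube hx (by linarith [div_one_add_le_half hz0 hz1]) hr
  rw [distinct_integrand_eq hz0, sub_eq_add_neg, ← neg_div]
  refine add_le_add_right ((div_le_div_of_nonneg_right h1 (by linarith)).trans ?_) _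
  rw [div_pow, div_div, div_le_div_iff₀ (by positivity) (by norm_num)]
  nlinarith [mul_nonneg hz0 (sub_nonneg.2 hz1), pow_nonneg hz0 2, pow_nonneg hz0 3,
    mul_nonneg (pow_nonneg hz0 2) (sub_nonneg.2 hz1),
    mul_nonneg (pow_nonneg hz0 3) (sub_nonneg.2 hz1)]

lemma le_oddVertLim_add {r : ℕ} (hr : 1 ≤ r) :
    Real.log 2 - 1 / 12 ≤ oddVertLim (r + 1) 0 + oddVertLim r 0 := by
  have h : ∫ s in (0 : ℝ)..1, (2 * (1 / (1 + s)) - (s - s ^ 2)) = 2 * Real.log 2 - 1 / 6 := by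
    have i1 : IntervalIntegrable (fun s : ℝ => s) MeasureTheory.volume 0 1 :=
      continuous_id.intervalIntegrable _ _
    have i2 : IntervalIntegrable (fun s : ℝ => s ^ 2) MeasureTheory.volume 0 1 :=
      (continuous_pow 2).intervalIntegrable _ _
    rw [intervalIntegral.integral_sub (intervalIntegrable_inv_one_add.const_mul 2) (i1.sub i2),
      intervalIntegral.integral_const_mul, integral_inv_one_add,
      intervalIntegral.integral_sub i1 i2, integral_id, integral_pow]
    norm_num
  have hle : ∫ s in (0 : ℝ)..1, (2 * (1 / (1 + s)) - (s - s ^ 2)) ≤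
      ∫ s in (0 : ℝ)..1, ((1 - s) ^ 0 * altGeom (r + 1) s + (1 - s) ^ 0 * altGeom r s) := by
    refine intervalIntegral.integral_mono_on zero_le_one
      ((intervalIntegrable_inv_one_add.const_mul 2).sub
        (Continuous.intervalIntegrable (by fun_prop) _ _))
      ((intervalIntegrable_oddVertLim _ _).add (intervalIntegrable_oddVertLim _ _)) fun s hs => ?_
    have hs0 := hs.1
    have hs1 := hs.2
    have hp : (-s) ^ r ≤ s := by
      refine (le_abs_self _).trans ?_
      rw [abs_pow, abs_neg, abs_of_nonneg hs0]
      exact pow_le_of_le_one hs0 hs1 (by omega)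
    rw [altGeom_eq_sub hs0, altGeom_eq_sub hs0, pow_zero, one_mul, one_mul, pow_succ (-s) r]
    have h3 : (-s) ^ r * (1 - s) / (1 + s) ≤ s - s ^ 2 := by
      rw [div_le_iff₀ (by linarith)]
      nlinarith [mul_le_mul_of_nonneg_right hp (sub_nonneg.2 hs1),
        mul_nonneg (mul_nonneg hs0 hs0) (sub_nonneg.2 hs1)]
    have h4 : (-s) ^ r * (1 - s) / (1 + s) =
        (-s) ^ r * -s / (1 + s) + (-s) ^ r / (1 + s) := by
      ring
    linarith
  rw [h, intervalIntegral.integral_add (intervalIntegrable_oddVertLim _ _)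
    (intervalIntegrable_oddVertLim _ _)] at hle
  unfold oddVertLim
  linarith

lemma tendsto_oddVertLim :
    Filter.Tendsto (fun r => oddVertLim r 0) Filter.atTop (nhds (Real.log 2 / 2)) := by
  rw [tendsto_iff_dist_tendsto_zero]
  exact squeeze_zero (fun _ => dist_nonneg) abs_oddVertLim_sub_le
    tendsto_one_div_add_atTop_nhds_zero_nat

lemma tendsto_distinctVertLim :
    Filter.Tendsto (fun r => distinctVertLim r 0) Filter.atTop (nhds (Real.log 3 / 2)) := by
  rw [tendsto_iff_dist_tendsto_zero]
  exact squeeze_zero (fun _ => dist_nonneg) abs_distinctVertLim_sub_le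
    (tendsto_pow_atTop_nhds_zero_of_lt_one (by norm_num) (by norm_num))

/-- For each `h ≥ 2` the limit `γ_h := lim_{n→∞} a_h(n)/b_h(n)` exists and satisfies
`γ_h > 1`, and `γ_h → log 4 / log 3` as `h → ∞`. -/
theorem hook_ratio_limits :
    ∃ γ : ℕ → ℝ,
      (∀ h : ℕ, 2 ≤ h →
        Filter.Tendsto (fun n : ℕ => (hookOdd h n : ℝ) / (hookDistinct h n : ℝ))
          Filter.atTop (nhds (γ h)) ∧ 1 < γ h) ∧
      Filter.Tendsto γ Filter.atTop (nhds (Real.log 4 / Real.log 3)) := by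
  refine ⟨fun h => (oddVertLim h 0 + oddVertLim (h - 1) 0) / distinctVertLim h 0,
    fun h hh => ?_, ?_⟩
  · obtain ⟨r, rfl⟩ : ∃ r, h = r + 1 := ⟨h - 1, by omega⟩
    have hpos := distinctVertLim_pos (show 1 ≤ r + 1 by omega)
    simp only [Nat.add_sub_cancel]
    constructor
    · refine ((tendsto_hookOdd r).div (tendsto_hookDistinct (r + 1)) hpos.ne').congr fun n => ?_
      exact div_div_div_cancel_right₀ (oddSum_pos n).ne' _ _
    · rw [one_lt_div hpos]
      have h1 := le_oddVertLim_add (show 1 ≤ r by omega)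
      have h2 := distinctVertLim_le hh
      linarith [Real.log_two_gt_d9, Real.log_three_lt_d9]
  · have h3 : Real.log 3 ≠ 0 := by linarith [Real.log_three_gt_d9]
    have e : Real.log 4 / Real.log 3 = (Real.log 2 / 2 + Real.log 2 / 2) / (Real.log 3 / 2) := by
      rw [show (4 : ℝ) = 2 ^ 2 by norm_num, Real.log_pow]
      field_simp
      norm_num
    rw [e]
    exact (tendsto_oddVertLim.add (tendsto_oddVertLim.comp (Filter.tendsto_sub_atTop_nat 1))).div
      tendsto_distinctVertLim (div_ne_zero h3 two_ne_zero)
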